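/- Let $1 \le p \le q < s$, $1 \le r \le s$, and $T \in \mathcal{L}(U;X)$. Then $T$ is weakly anisotropic $(s,q,r;p)$-summing if and only if there is a constant $D>0$ such that for all $m,n \in \mathbb{N}$, all $u_1,\dots,u_m \in U$ and $x_1^*,\dots,x_n^* \in X^*$: $\left(\sum_{j=1}^m\left(\sum_{k=1}^n |x_k^*(T u_j)|^s\right)^{q/s}\right)^{1/q} \le D \left(\sum_{k=1}^n\|x_k^*\|^r\right)^{1/r}\|(u_j)_{j=1}^m\|_{w,p}$. -/

import Mathlib

open scoped BigOperators NNReal ENNReal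

noncomputable section

/-- `(xs k)` belongs to `ℓ_r(X*)`. -/
def MemLr (r : ℝ) {X : Type*} [NormedAddCommGroup X] [NormedSpace ℝ X]
    (xs : ℕ → X →L[ℝ] ℝ) : Prop :=
  Summable fun k => ‖xs k‖ ^ r

/-- The `ℓ_r(X*)` norm. -/
noncomputable def lrNorm (r : ℝ) {X : Type*} [NormedAddCommGroup X] [NormedSpace ℝ X]
    (xs : ℕ → X →L[ℝ] ℝ) : ℝ :=
  (∑' k, ‖xs k‖ ^ r) ^ (1 / r)

/-- Weakly `q`-summable sequences. -/
def WeaklySummable (q : ℝ) {X : Type*} [NormedAddCommGroup X] [NormedSpace ℝ X]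
    (x : ℕ → X) : Prop :=
  ∀ f : X →L[ℝ] ℝ, Summable fun j => |f (x j)| ^ q

/-- The weak `ℓ_q` norm. -/
noncomputable def weakNorm (q : ℝ) {X : Type*} [NormedAddCommGroup X] [NormedSpace ℝ X]
    (x : ℕ → X) : ℝ :=
  ⨆ f : {f : X →L[ℝ] ℝ // ‖f‖ ≤ 1}, (∑' j, |f.1 (x j)| ^ q) ^ (1 / q)

/-- Anisotropic `(s,q,r)`-summable sequences. -/
def AnisoSummable (s q r : ℝ) {X : Type*} [NormedAddCommGroup X] [NormedSpace ℝ X]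
    (x : ℕ → X) : Prop :=
  ∀ xs : ℕ → X →L[ℝ] ℝ, MemLr r xs →
    (∀ j, Summable fun k => |xs k (x j)| ^ s) ∧
      Summable fun j => (∑' k, |xs k (x j)| ^ s) ^ (q / s)

/-- The anisotropic `(s,q,r)` norm. -/
noncomputable def anisoNorm (s q r : ℝ) {X : Type*} [NormedAddCommGroup X] [NormedSpace ℝ X]
    (x : ℕ → X) : ℝ :=
  ⨆ xs : {xs : ℕ → X →L[ℝ] ℝ // MemLr r xs ∧ lrNorm r xs ≤ 1},
    (∑' j, (∑' k, |xs.1 k (x j)| ^ s) ^ (q / s)) ^ (1 / q)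

/-- The weak `ℓ_p` norm of a finite family. -/
noncomputable def weakNormFin (p : ℝ) {X : Type*} [NormedAddCommGroup X] [NormedSpace ℝ X]
    {m : ℕ} (u : Fin m → X) : ℝ :=
  ⨆ f : {f : X →L[ℝ] ℝ // ‖f‖ ≤ 1}, (∑ j, |f.1 (u j)| ^ p) ^ (1 / p)

/-- Weakly anisotropic `(s,q,r;p)`-summing operators. -/
def WeaklyAnisoSumming (s q r p : ℝ) {U X : Type*} [NormedAddCommGroup U] [NormedSpace ℝ U]
    [NormedAddCommGroup X] [NormedSpace ℝ X] (T : U →L[ℝ] X) : Prop :=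
  ∀ u : ℕ → U, WeaklySummable p u → AnisoSummable s q r fun j => T (u j)

section Helpers

variable {U X : Type*} [NormedAddCommGroup U] [NormedSpace ℝ U]
  [NormedAddCommGroup X] [NormedSpace ℝ X]

lemma aux_hom {s q : ℝ} (hs : 0 < s) (T : U →L[ℝ] X) {a b : ℝ} (ha : 0 ≤ a) (hb : 0 ≤ b)
    {m n : ℕ} (u : Fin m → U) (xs : Fin n → X →L[ℝ] ℝ) :
    ∑ j, (∑ k, |(b • xs k) (T (a • u j))| ^ s) ^ (q / s) =
      (a * b) ^ q * ∑ j, (∑ k, |xs k (T (u j))| ^ s) ^ (q / s) := by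
  have hab : 0 ≤ a * b := mul_nonneg ha hb
  rw [Finset.mul_sum]
  refine Finset.sum_congr rfl fun j _ => ?_
  have h1 : ∀ k, |(b • xs k) (T (a • u j))| ^ s = (a * b) ^ s * |xs k (T (u j))| ^ s := by
    intro k
    rw [← Real.mul_rpow hab (abs_nonneg _)]
    congr 1
    simp only [map_smul, ContinuousLinearMap.smul_apply, smul_eq_mul, abs_mul,
      abs_of_nonneg ha, abs_of_nonneg hb]
    ring
  simp_rw [h1]
  rw [← Finset.mul_sum, Real.mul_rpow (Real.rpow_nonneg hab _)
    (Finset.sum_nonneg fun k _ => Real.rpow_nonneg (abs_nonneg _) _), ← Real.rpow_mul hab,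
    mul_div_cancel₀ _ hs.ne']

lemma aux_bdd {p : ℝ} (hp : 1 ≤ p) {m : ℕ} (u : Fin m → U) :
    BddAbove (Set.range fun f : {f : U →L[ℝ] ℝ // ‖f‖ ≤ 1} =>
      (∑ j, |f.1 (u j)| ^ p) ^ (1 / p)) := by
  refine ⟨(∑ j, ‖u j‖ ^ p) ^ (1 / p), ?_⟩
  rintro _ ⟨f, rfl⟩
  have hp0 : 0 < p := by linarith
  dsimp only
  gcongr with j
  have := f.1.le_of_opNorm_le f.2 (u j)
  simpa using this

lemma aux_weak_nonneg {p : ℝ} {m : ℕ} (u : Fin m → U) : 0 ≤ weakNormFin p u :=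
  Real.iSup_nonneg fun _ => by positivity

lemma aux_weak_le {p : ℝ} (hp : 1 ≤ p) {m : ℕ} (u : Fin m → U) (f : U →L[ℝ] ℝ) (hf : ‖f‖ ≤ 1) :
    ∑ j, |f (u j)| ^ p ≤ weakNormFin p u ^ p := by
  have hp0 : 0 < p := by linarith
  have h := le_ciSup (aux_bdd hp u) ⟨f, hf⟩
  have h0 : 0 ≤ ∑ j, |f (u j)| ^ p := by positivity
  have h2 := Real.rpow_le_rpow (by positivity) h hp0.le
  dsimp only at h2
  rw [← Real.rpow_mul h0, one_div_mul_cancel hp0.ne', Real.rpow_one] at h2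
  exact h2

lemma aux_unif {p : ℝ} (hp : 1 ≤ p) (u : ℕ → U) (hu : WeaklySummable p u) :
    ∃ C : ℝ, 0 ≤ C ∧ ∀ m : ℕ, weakNormFin p (fun j : Fin m => u j) ≤ C := by
  have hp0 : 0 < p := by linarith
  let P : ℝ≥0∞ := ENNReal.ofReal p
  have hP : P.toReal = p := ENNReal.toReal_ofReal hp0.le
  haveI : Fact (1 ≤ P) := ⟨by simpa [P] using hp⟩
  have hP0 : 0 < P.toReal := by rw [hP]; exact hp0
  let E := lp (fun _ : ℕ => ℝ) P
  let g0 : ℕ → (U →L[ℝ] ℝ) →ₗ[ℝ] E := fun m =>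
    ∑ j ∈ Finset.range m, (lp.lsingle (𝕜 := ℝ) (E := fun _ : ℕ => ℝ) P j) ∘ₗ
      (ContinuousLinearMap.apply ℝ ℝ (u j)).toLinearMap
  have hg0 : ∀ m f, ‖g0 m f‖ ^ p = ∑ j ∈ Finset.range m, |f (u j)| ^ p := by
    intro m f
    have := lp.norm_sum_single (E := fun _ : ℕ => ℝ) hP0 (fun j => f (u j)) (Finset.range m)
    rw [hP] at this
    simp only [Real.norm_eq_abs] at this
    rw [← this]
    congr 2
    simp only [g0, LinearMap.sum_apply]
    rfl
  have hcont : ∀ m f, ‖g0 m f‖ ≤ (∑ j ∈ Finset.range m, ‖u j‖ ^ p) ^ (1 / p) * ‖f‖ := by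
    intro m f
    rw [← Real.rpow_le_rpow_iff (norm_nonneg _) (by positivity) hp0, hg0,
      Real.mul_rpow (by positivity) (by positivity), ← Real.rpow_mul (by positivity),
      one_div_mul_cancel hp0.ne', Real.rpow_one, Finset.sum_mul]
    refine Finset.sum_le_sum fun j _ => ?_
    rw [← Real.mul_rpow (by positivity) (by positivity), mul_comm]
    gcongr
    exact f.le_opNorm (u j)
  let g : ℕ → (U →L[ℝ] ℝ) →L[ℝ] E := fun m => (g0 m).mkContinuous _ (hcont m)
  have hgg : ∀ m f, g m f = g0 m f := fun m f => rfl
  obtain ⟨C, hC⟩ := banach_steinhaus (g := g) (by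
    intro f
    refine ⟨(∑' j, |f (u j)| ^ p) ^ (1 / p), fun m => ?_⟩
    have h0 : 0 ≤ ∑' j, |f (u j)| ^ p := tsum_nonneg fun j => by positivity
    rw [hgg, ← Real.rpow_le_rpow_iff (norm_nonneg _) (by positivity) hp0, hg0,
      ← Real.rpow_mul h0, one_div_mul_cancel hp0.ne', Real.rpow_one]
    exact (hu f).sum_le_tsum _ fun j _ => by positivity)
  refine ⟨C, (norm_nonneg _).trans (hC 0), fun m => ?_⟩
  haveI : Nonempty {f : U →L[ℝ] ℝ // ‖f‖ ≤ 1} := ⟨⟨0, by simp⟩⟩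
  refine ciSup_le fun f => ?_
  have h1 : ∑ j : Fin m, |f.1 (u j)| ^ p = ‖g m f.1‖ ^ p := by
    rw [hgg, hg0, Finset.sum_range]
  rw [h1, ← Real.rpow_mul (norm_nonneg _), mul_one_div_cancel hp0.ne', Real.rpow_one]
  exact ((g m).le_of_opNorm_le (hC m) _).trans
    (mul_le_of_le_one_right ((norm_nonneg _).trans (hC 0)) f.2)

lemma aux_inner {s r : ℝ} (hr : 1 ≤ r) (hrs : r ≤ s) {κ : Type*} (xs : κ → X →L[ℝ] ℝ)
    (h : Summable fun k => ‖xs k‖ ^ r) (x : X) : Summable fun k => |xs k x| ^ s := by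
  have hr0 : 0 < r := by linarith
  have hs0 : 0 < s := by linarith
  have h1 : Summable fun k => ‖xs k‖ ^ s := by
    refine Summable.of_norm_bounded_eventually h ?_
    have := h.tendsto_cofinite_zero.eventually (gt_mem_nhds zero_lt_one)
    filter_upwards [this] with k hk
    have hk1 : ‖xs k‖ ≤ 1 := by
      by_contra hc
      push Not at hc
      exact absurd hk (not_lt.2 (Real.one_le_rpow hc.le hr0.le))
    rw [Real.norm_of_nonneg (by positivity)]
    rcases (norm_nonneg (xs k)).eq_or_lt with h0 | h0
    · rw [← h0, Real.zero_rpow hr0.ne', Real.zero_rpow hs0.ne']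
    · exact Real.rpow_le_rpow_of_exponent_ge h0 hk1 hrs
  refine Summable.of_nonneg_of_le (fun k => by positivity) (fun k => ?_) (h1.mul_right (‖x‖ ^ s))
  rw [← Real.mul_rpow (norm_nonneg _) (norm_nonneg _)]
  gcongr
  exact (xs k).le_opNorm x

lemma aux_countable {s q r p : ℝ} (hp : 1 ≤ p) (hq : 0 < q) (hs : 0 < s) (hr : 1 ≤ r)
    {T : U →L[ℝ] X}
    (hT : WeaklyAnisoSumming s q r p T) {ι κ : Type*} [Countable ι] [Countable κ]
    (u : ι → U) (hu : ∀ f : U →L[ℝ] ℝ, Summable fun j => |f (u j)| ^ p)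
    (xs : κ → X →L[ℝ] ℝ) (hxs : Summable fun k => ‖xs k‖ ^ r) :
    Summable fun j => (∑' k, |xs k (T (u j))| ^ s) ^ (q / s) := by
  obtain ⟨e, he⟩ := exists_injective_nat ι
  obtain ⟨d, hd⟩ := exists_injective_nat κ
  have hp0 : p ≠ 0 := by linarith
  have hr0 : r ≠ 0 := by linarith
  let u' : ℕ → U := Function.extend e u 0
  let xs' : ℕ → X →L[ℝ] ℝ := Function.extend d xs 0
  have hu1 : ∀ j, u' (e j) = u j := fun j => he.extend_apply _ _ _
  have hu2 : ∀ n, n ∉ Set.range e → u' n = 0 := fun n hn =>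
    Function.extend_apply' _ _ _ (by simpa using hn)
  have hx1 : ∀ j, xs' (d j) = xs j := fun j => hd.extend_apply _ _ _
  have hx2 : ∀ n, n ∉ Set.range d → xs' n = 0 := fun n hn =>
    Function.extend_apply' _ _ _ (by simpa using hn)
  have h := (hT u' (fun f => (he.summable_iff (fun n hn => by
      simp [hu2 n hn, Real.zero_rpow hp0])).1 (by
        simpa [Function.comp_def, hu1] using hu f)) xs' ((hd.summable_iff (fun n hn => by
      simp [hx2 n hn, Real.zero_rpow hr0])).1 (by
        simpa [Function.comp_def, hx1] using hxs))).2
  have h2 := h.comp_injective he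
  refine h2.congr fun j => ?_
  simp only [Function.comp_apply, hu1]
  congr 1
  rw [← hd.tsum_eq (f := fun k => |xs' k (T (u j))| ^ s)]
  · simp only [hx1]
  · intro n hn
    by_contra hc
    exact hn (by simp [hx2 n hc, Real.zero_rpow hs.ne'])

lemma aux_main {s q r p : ℝ} (hp : 1 ≤ p) (hpq : p ≤ q) (hqs : q < s) (hr : 1 ≤ r)
    (hrs : r ≤ s) {T : U →L[ℝ] X} (hT : WeaklyAnisoSumming s q r p T) :
    ∃ D : ℝ, 0 < D ∧ ∀ (m n : ℕ) (u : Fin m → U) (xs : Fin n → X →L[ℝ] ℝ),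
      (∀ f : U →L[ℝ] ℝ, ‖f‖ ≤ 1 → ∑ j, |f (u j)| ^ p ≤ 1) → ∑ k, ‖xs k‖ ^ r ≤ 1 →
      ∑ j, (∑ k, |xs k (T (u j))| ^ s) ^ (q / s) ≤ D := by
  have hp0 : 0 < p := by linarith
  have hq0 : 0 < q := by linarith
  have hs0 : 0 < s := by linarith
  have hr0 : 0 < r := by linarith
  by_contra! hcon
  let t : ℕ → ℝ := fun i => (1 / 2) ^ i
  have ht0 : ∀ i, 0 < t i := fun i => by positivity
  have hts : ∀ z : ℝ, 1 ≤ z → Summable fun i => t i ^ z := by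
    intro z hz
    refine Summable.of_nonneg_of_le (fun i => (Real.rpow_pos_of_pos (ht0 i) _).le) (fun i => ?_)
      (summable_geometric_of_lt_one (r := (1 / 2 : ℝ)) (by norm_num) (by norm_num))
    have := Real.rpow_le_rpow_of_exponent_ge (ht0 i)
      (pow_le_one₀ (by norm_num) (by norm_num)) hz
    rwa [Real.rpow_one] at this
  have hD : ∀ i, 0 < ((t i * t i) ^ q)⁻¹ := fun i =>
    inv_pos.2 (Real.rpow_pos_of_pos (mul_pos (ht0 i) (ht0 i)) _)
  choose m n u xs hu hxs hbig using fun i => hcon _ (hD i)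
  let v : (Σ i, Fin (m i)) → U := fun a => t a.1 • u a.1 a.2
  let y : (Σ i, Fin (n i)) → X →L[ℝ] ℝ := fun a => t a.1 • xs a.1 a.2
  have hy : Summable fun k => ‖y k‖ ^ r := by
    refine (summable_sigma_of_nonneg fun _ => by positivity).2 ⟨fun i => .of_finite, ?_⟩
    refine Summable.of_nonneg_of_le (fun i => tsum_nonneg fun _ => by positivity) (fun i => ?_)
      (hts r hr)
    rw [tsum_fintype]
    simp only [y, norm_smul, Real.norm_of_nonneg (ht0 i).le,
      Real.mul_rpow (ht0 i).le (norm_nonneg _)]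
    rw [← Finset.mul_sum]
    exact mul_le_of_le_one_right (Real.rpow_nonneg (ht0 i).le _) (hxs i)
  have hv : ∀ f : U →L[ℝ] ℝ, Summable fun j => |f (v j)| ^ p := by
    intro f
    obtain ⟨c, hc0, hc⟩ : ∃ c : ℝ, 0 < c ∧ ‖f‖ ≤ c := ⟨‖f‖ + 1, by positivity, by linarith⟩
    refine (summable_sigma_of_nonneg fun _ => by positivity).2 ⟨fun i => .of_finite, ?_⟩
    refine Summable.of_nonneg_of_le (fun i => tsum_nonneg fun _ => by positivity) (fun i => ?_)
      ((hts p hp).mul_right (c ^ p))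
    rw [tsum_fintype]
    have h1 := hu i (c⁻¹ • f) (by
      rw [norm_smul, Real.norm_of_nonneg (by positivity), inv_mul_le_iff₀ hc0]; simpa using hc)
    have h2 : ∀ j, |f (v ⟨i, j⟩)| ^ p = (t i ^ p * c ^ p) * |(c⁻¹ • f) (u i j)| ^ p := by
      intro j
      rw [← Real.mul_rpow (ht0 i).le hc0.le,
        ← Real.mul_rpow (mul_pos (ht0 i) hc0).le (abs_nonneg _)]
      congr 1
      simp only [v, map_smul, ContinuousLinearMap.smul_apply, smul_eq_mul, abs_mul,
        abs_of_pos (ht0 i), abs_of_pos (inv_pos.2 hc0)]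
      field_simp
    simp only [h2]
    rw [← Finset.mul_sum]
    exact mul_le_of_le_one_right
      (mul_nonneg (Real.rpow_nonneg (ht0 i).le _) (Real.rpow_nonneg hc0.le _)) h1
  have hsum := aux_countable hp hq0 hs0 hr hT v hv y hy
  have hsig := ((summable_sigma_of_nonneg fun _ =>
    Real.rpow_nonneg (tsum_nonneg fun _ => by positivity) _).1 hsum).2
  obtain ⟨i, hi⟩ := (hsig.tendsto_atTop_zero.eventually (gt_mem_nhds zero_lt_one)).exists
  rw [tsum_fintype] at hi
  have h1 : 1 < ∑ j, (∑ k, |(t i • xs i k) (T (t i • u i j))| ^ s) ^ (q / s) := by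
    rw [aux_hom hs0 T (ht0 i).le (ht0 i).le]
    have := hbig i
    rwa [inv_lt_iff_one_lt_mul₀' (inv_pos.1 (hD i))] at this
  refine absurd (h1.trans_le ?_) (not_lt.2 hi.le)
  refine Finset.sum_le_sum fun j _ => ?_
  refine Real.rpow_le_rpow (by positivity) ?_ (by positivity)
  have hin := aux_inner hr hrs y hy (T (v ⟨i, j⟩))
  have h3 := hin.sum_le_tsum (Finset.univ.map (Function.Embedding.sigmaMk i))
    fun _ _ => by positivity
  rw [Finset.sum_map] at h3
  exact h3

end Helpers

theorem stmt15 {U X : Type*} [NormedAddCommGroup U] [NormedSpace ℝ U] [CompleteSpace U]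
    [NormedAddCommGroup X] [NormedSpace ℝ X] [CompleteSpace X]
    {s q r p : ℝ} (hp : 1 ≤ p) (hpq : p ≤ q) (hqs : q < s) (hr : 1 ≤ r) (hrs : r ≤ s)
    (T : U →L[ℝ] X) :
    WeaklyAnisoSumming s q r p T ↔
      ∃ D : ℝ, 0 < D ∧ ∀ (m n : ℕ) (u : Fin m → U) (xs : Fin n → X →L[ℝ] ℝ),
        (∑ j, (∑ k, |xs k (T (u j))| ^ s) ^ (q / s)) ^ (1 / q) ≤
          D * (∑ k, ‖xs k‖ ^ r) ^ (1 / r) * weakNormFin p u := by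
  have hp0 : 0 < p := by linarith
  have hq0 : 0 < q := by linarith
  have hs0 : 0 < s := by linarith
  have hr0 : 0 < r := by linarith
  constructor
  · intro hT
    obtain ⟨D, hD, h⟩ := aux_main hp hpq hqs hr hrs hT
    refine ⟨D ^ (1 / q), Real.rpow_pos_of_pos hD _, fun m n u xs => ?_⟩
    set W := weakNormFin p u with hW
    have hW0 : 0 ≤ W := aux_weak_nonneg u
    set A := (∑ k, ‖xs k‖ ^ r) ^ (1 / r) with hA
    have hA0 : 0 ≤ A := by positivity
    have hAr : ∑ k, ‖xs k‖ ^ r = A ^ r := by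
      rw [hA, ← Real.rpow_mul (by positivity), one_div_mul_cancel hr0.ne', Real.rpow_one]
    set S := ∑ j, (∑ k, |xs k (T (u j))| ^ s) ^ (q / s) with hS
    have hS0 : 0 ≤ S := by positivity
    have key : ∀ ε : ℝ, 0 < ε → S ^ (1 / q) ≤ D ^ (1 / q) * (A + ε) * (W + ε) := by
      intro ε hε
      have ha : 0 < W + ε := by positivity
      have hb : 0 < A + ε := by positivity
      have h1 := h m n (fun j => (W + ε)⁻¹ • u j) (fun k => (A + ε)⁻¹ • xs k) (by
        intro f hf
        have h2 : ∀ j, |f ((W + ε)⁻¹ • u j)| ^ p = ((W + ε) ^ p)⁻¹ * |f (u j)| ^ p := by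
          intro j
          rw [map_smul, smul_eq_mul, abs_mul, abs_of_pos (inv_pos.2 ha),
            Real.mul_rpow (by positivity) (abs_nonneg _), Real.inv_rpow ha.le]
        simp only [h2]
        rw [← Finset.mul_sum, inv_mul_le_iff₀ (by positivity), mul_one]
        refine (aux_weak_le hp u f hf).trans ?_
        exact Real.rpow_le_rpow hW0 (by linarith) hp0.le) (by
        have h2 : ∀ k, ‖(A + ε)⁻¹ • xs k‖ ^ r = ((A + ε) ^ r)⁻¹ * ‖xs k‖ ^ r := by
          intro j
          rw [norm_smul, Real.norm_of_nonneg (inv_pos.2 hb).le,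
            Real.mul_rpow (by positivity) (norm_nonneg _), Real.inv_rpow hb.le]
        simp only [h2]
        rw [← Finset.mul_sum, inv_mul_le_iff₀ (by positivity), mul_one, hAr]
        exact Real.rpow_le_rpow hA0 (by linarith) hr0.le)
      rw [aux_hom hs0 T (inv_pos.2 ha).le (inv_pos.2 hb).le, ← mul_inv,
        Real.inv_rpow (by positivity), inv_mul_le_iff₀ (by positivity)] at h1
      have h3 := Real.rpow_le_rpow hS0 h1 (by positivity : 0 ≤ 1 / q)
      rw [Real.mul_rpow (by positivity) hD.le, ← Real.rpow_mul (by positivity),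
        mul_one_div_cancel hq0.ne', Real.rpow_one] at h3
      linarith
    have hlim : Filter.Tendsto (fun ε : ℝ => D ^ (1 / q) * (A + ε) * (W + ε))
        (nhdsWithin 0 (Set.Ioi 0)) (nhds (D ^ (1 / q) * A * W)) := by
      have : Continuous fun ε : ℝ => D ^ (1 / q) * (A + ε) * (W + ε) := by fun_prop
      have h2 := this.tendsto 0
      simp only [add_zero] at h2
      exact h2.mono_left nhdsWithin_le_nhds
    refine ge_of_tendsto hlim ?_
    filter_upwards [self_mem_nhdsWithin] with ε hε using key ε hε
  · rintro ⟨D, hD, h⟩ u hu xs hxs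
    have hin : ∀ j, Summable fun k => |xs k (T (u j))| ^ s := fun j => aux_inner hr hrs xs hxs _
    refine ⟨hin, ?_⟩
    obtain ⟨C, hC0, hC⟩ := aux_unif hp u hu
    set L := (∑' k, ‖xs k‖ ^ r) ^ (1 / r) with hL
    have hL0 : 0 ≤ L := Real.rpow_nonneg (tsum_nonneg fun k => by positivity) _
    refine summable_of_sum_range_le (c := (D * L * C) ^ q)
      (fun j => Real.rpow_nonneg (tsum_nonneg fun k => by positivity) _) fun m => ?_
    have hlim : Filter.Tendsto
        (fun n => ∑ j ∈ Finset.range m, (∑ k ∈ Finset.range n, |xs k (T (u j))| ^ s) ^ (q / s))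
        Filter.atTop
        (nhds (∑ j ∈ Finset.range m, (∑' k, |xs k (T (u j))| ^ s) ^ (q / s))) :=
      tendsto_finsetSum _ fun j _ =>
        ((hin j).hasSum.tendsto_sum_nat).rpow_const (Or.inr (by positivity))
    refine le_of_tendsto' hlim fun n => ?_
    have h1 := h m n (fun j => u j) (fun k => xs k)
    have h2 : (∑ k : Fin n, ‖xs k‖ ^ r) ^ (1 / r) ≤ L := by
      refine Real.rpow_le_rpow (by positivity) ?_ (by positivity)
      rw [← Finset.sum_range (fun k => ‖xs k‖ ^ r)]
      exact hxs.sum_le_tsum _ fun _ _ => by positivity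
    have h3 : D * (∑ k : Fin n, ‖xs k‖ ^ r) ^ (1 / r) * weakNormFin p (fun j : Fin m => u j) ≤
        D * L * C := by
      have := hC m
      have := aux_weak_nonneg (p := p) (fun j : Fin m => u j)
      gcongr
    have h4 := Real.rpow_le_rpow (by positivity) (h1.trans h3) hq0.le
    rw [← Real.rpow_mul (by positivity), one_div_mul_cancel hq0.ne', Real.rpow_one] at h4
    simpa only [Finset.sum_range] using h4
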